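/- arXiv:1705.09091 — 5 statements merged into one kernel-verified Lean document; each statement's English description precedes it below -/
import Mathlib

section
/- Let H be a complex Hilbert space and A : H → H a bounded selfadjoint operator with ⟨Au,u⟩ ≥ c‖u‖² for all u (c > 0). Let l₁,…,lₙ be positive integers, a₁,…,aₙ ≥ 0 reals, ϰ = Σₖ aₖ/lₖ ≤ 1 and 0 ≤ μ ≤ 1 − ϰ. Then for every ξ ∈ ℝⁿ, every t ∈ (0,∞)ⁿ and every h > 0 the operator A + (Σₖ tₖ|ξₖ|^{lₖ} + h^{−1})·I is invertible in L(H), and there exists a constant C_μ > 0, independent of ξ, t and h, such that ‖(∏ₖ tₖ^{aₖ/lₖ}) (∏ₖ |ξₖ|^{aₖ}) h^{−μ} A^{1−ϰ−μ} (A + (Σₖ tₖ|ξₖ|^{lₖ} + h^{−1})·I)^{−1}‖_{L(H)} ≤ C_μ. -/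
/-- Fractional power `A^θ` of a bounded selfadjoint operator via the continuous
functional calculus applied to `s ↦ s ^ θ`. -/
noncomputable def fracPow {H : Type*} [NormedAddCommGroup H] [InnerProductSpace ℂ H]
    [CompleteSpace H] (A : H →L[ℂ] H) (θ : ℝ) : H →L[ℂ] H :=
  cfc (fun s : ℝ => s ^ θ) A

/-- The spectrum of a selfadjoint operator is bounded below by any coercivity constant. -/
theorem le_of_mem_spectrum_of_coercive {H : Type*} [NormedAddCommGroup H]
    [InnerProductSpace ℂ H] [CompleteSpace H] {A : H →L[ℂ] H} (hA : IsSelfAdjoint A) {c : ℝ}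
    (hcoer : ∀ u : H, c * ‖u‖ ^ 2 ≤ (inner ℂ (A u) u : ℂ).re) {s : ℝ}
    (hs : s ∈ spectrum ℝ A) : c ≤ s := by
  have hle : algebraMap ℝ (H →L[ℂ] H) c ≤ A := by
    rw [ContinuousLinearMap.le_def, ContinuousLinearMap.isPositive_def']
    refine ⟨hA.sub (IsSelfAdjoint.algebraMap _ (IsSelfAdjoint.all c)), fun u => ?_⟩
    have h := hcoer u
    have hnorm : (inner ℂ (c • u) u : ℂ).re = c * ‖u‖ ^ 2 := by
      rw [← Complex.coe_smul, inner_smul_left, inner_self_eq_norm_sq_to_K]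
      simp [← Complex.ofReal_pow]
    simp only [ContinuousLinearMap.reApplyInnerSelf_apply, Algebra.algebraMap_eq_smul_one,
      sub_apply, smul_apply, one_apply_eq_self, inner_sub_left, map_sub, RCLike.re_eq_complex_re,
      hnorm]
    linarith
  exact (algebraMap_le_iff_le_spectrum (a := A)).1 hle s hs

/-- Weighted AM-GM with two distinguished terms carrying weights `μ` and `1 - ∑ w - μ`. -/
theorem prod_rpow_mul_rpow_mul_rpow_le {ι : Type*} [Fintype ι] {w z : ι → ℝ} {μ p q : ℝ}
    (hw : ∀ i, 0 ≤ w i) (hz : ∀ i, 0 ≤ z i) (hμ : 0 ≤ μ) (hμ1 : μ ≤ 1 - ∑ i, w i)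
    (hp : 0 ≤ p) (hq : 0 ≤ q) :
    (∏ i, z i ^ w i) * p ^ μ * q ^ (1 - ∑ i, w i - μ) ≤ q + (∑ i, z i + p) := by
  have hw1 : ∀ i, w i ≤ 1 := fun i =>
    (Finset.single_le_sum (fun j _ => hw j) (Finset.mem_univ i)).trans (by linarith)
  have hsum : 0 ≤ ∑ i, w i := Finset.sum_nonneg fun i _ => hw i
  have key := Real.geom_mean_le_arith_mean_weighted Finset.univ
    (fun o : Option (Option ι) => o.elim (1 - ∑ i, w i - μ) fun o => o.elim μ w)
    (fun o => o.elim q fun o => o.elim p z)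
    (by rintro (_ | _ | i) - <;> simp [hw, hμ]; linarith)
    (by simp only [Fintype.sum_option, Option.elim_none, Option.elim_some]; ring)
    (by rintro (_ | _ | i) - <;> simp [hz, hp, hq])
  simp only [Fintype.prod_option, Fintype.sum_option, Option.elim_none, Option.elim_some] at key
  have hsumz : ∑ i, w i * z i ≤ ∑ i, z i :=
    Finset.sum_le_sum fun i _ => mul_le_of_le_one_left (hz i) (hw1 i)
  have hpμ : μ * p ≤ p := mul_le_of_le_one_left hp (by linarith)
  have hqθ : (1 - ∑ i, w i - μ) * q ≤ q := mul_le_of_le_one_left hq (by linarith)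
  linarith

/-- Shifting a selfadjoint operator with spectrum in `(0, ∞)` by `r ≥ 0` gives an invertible
operator, and `b A^θ (A + r)⁻¹` is the functional calculus of `s ↦ b (s^θ (s + r)⁻¹)`. -/
theorem isUnit_add_smul_one_and_smul_fracPow_comp_inverse {H : Type*} [NormedAddCommGroup H]
    [InnerProductSpace ℂ H] [CompleteSpace H] {A : H →L[ℂ] H} (hA : IsSelfAdjoint A)
    (hpos : ∀ s ∈ spectrum ℝ A, 0 < s) {r : ℝ} (hr : 0 ≤ r) (b θ : ℝ) :
    IsUnit (A + (r : ℂ) • (1 : H →L[ℂ] H)) ∧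
      (b : ℂ) • (fracPow A θ ∘L Ring.inverse (A + (r : ℂ) • (1 : H →L[ℂ] H))) =
        cfc (fun s : ℝ => b * (s ^ θ * (s + r)⁻¹)) A := by
  have hshift : A + (r : ℂ) • (1 : H →L[ℂ] H) = cfc (fun s : ℝ => s + r) A := by
    rw [cfc_add_const r (fun s => s) A, cfc_id' ℝ A, Algebra.algebraMap_eq_smul_one,
      Complex.coe_smul]
  have hne : ∀ s ∈ spectrum ℝ A, s + r ≠ 0 := fun s hs => by linarith [hpos s hs]
  have hpow : ContinuousOn (fun s : ℝ => s ^ θ) (spectrum ℝ A) :=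
    continuousOn_id.rpow_const fun s hs => Or.inl (hpos s hs).ne'
  have hcont : ContinuousOn (fun s : ℝ => s + r) (spectrum ℝ A) := by fun_prop
  have hinv : ContinuousOn (fun s : ℝ => (s + r)⁻¹) (spectrum ℝ A) := hcont.inv₀ hne
  refine ⟨hshift ▸ (isUnit_cfc_iff _ A hcont).2 hne, ?_⟩
  rw [hshift, ← cfc_inv (fun s : ℝ => s + r) A hne,
    cfc_const_mul b (fun s : ℝ => s ^ θ * (s + r)⁻¹) A (hpow.mul hinv),
    cfc_mul _ _ A hpow hinv, Complex.coe_smul]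
  rfl

/-- Lemma A₁ in the Hilbert-space case: for a bounded selfadjoint operator `A` with
`⟨Au,u⟩ ≥ c‖u‖²` (`c > 0`), positive integers `l k`, nonnegative reals `a k` with
`ϰ = ∑ k, a k / l k ≤ 1` and `0 ≤ μ ≤ 1 - ϰ`, the operator
`A + (∑ k, t k |ξ k| ^ (l k) + h⁻¹) • I` is invertible and
`‖(∏ k, t k ^ (a k / l k)) (∏ k, |ξ k| ^ (a k)) h^(-μ) A^(1-ϰ-μ)
    (A + (∑ k, t k |ξ k| ^ (l k) + h⁻¹) • I)⁻¹‖ ≤ C_μ`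
uniformly in `ξ`, `t` and `h`. -/
theorem lemmaA1_hilbert {H : Type*} [NormedAddCommGroup H] [InnerProductSpace ℂ H]
    [CompleteSpace H] (A : H →L[ℂ] H) (hA : IsSelfAdjoint A) (c : ℝ) (hc : 0 < c)
    (hcoer : ∀ u : H, c * ‖u‖ ^ 2 ≤ (inner ℂ (A u) u : ℂ).re)
    (n : ℕ) (l : Fin n → ℕ) (hl : ∀ k, 0 < l k) (a : Fin n → ℝ) (ha : ∀ k, 0 ≤ a k)
    (μ : ℝ) (hϰ : (∑ k, a k / (l k : ℝ)) ≤ 1) (hμ0 : 0 ≤ μ)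
    (hμ1 : μ ≤ 1 - ∑ k, a k / (l k : ℝ)) :
    ∃ C : ℝ, 0 < C ∧ ∀ (ξ : Fin n → ℝ) (t : Fin n → ℝ), (∀ k, 0 < t k) → ∀ h : ℝ, 0 < h →
      IsUnit (A + (((∑ k, t k * |ξ k| ^ (l k)) + h⁻¹ : ℝ) : ℂ) • (1 : H →L[ℂ] H)) ∧
      ‖(((∏ k, t k ^ (a k / (l k : ℝ))) * (∏ k, |ξ k| ^ (a k)) * h ^ (-μ) : ℝ) : ℂ) •
          (fracPow A (1 - (∑ k, a k / (l k : ℝ)) - μ) ∘L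
            Ring.inverse (A + (((∑ k, t k * |ξ k| ^ (l k)) + h⁻¹ : ℝ) : ℂ) •
              (1 : H →L[ℂ] H)))‖ ≤ C := by
  have hw : ∀ k, 0 ≤ a k / (l k : ℝ) := fun k => div_nonneg (ha k) (Nat.cast_nonneg _)
  have hpos : ∀ s ∈ spectrum ℝ A, 0 < s := fun s hs =>
    hc.trans_le (le_of_mem_spectrum_of_coercive hA hcoer hs)
  refine ⟨1, one_pos, fun ξ t ht h hh => ?_⟩
  have hz : ∀ k, 0 ≤ t k * |ξ k| ^ l k := fun k =>
    mul_nonneg (ht k).le (pow_nonneg (abs_nonneg _) _)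
  have hr : 0 ≤ (∑ k, t k * |ξ k| ^ l k) + h⁻¹ :=
    add_nonneg (Finset.sum_nonneg fun k _ => hz k) (inv_nonneg.2 hh.le)
  obtain ⟨hunit, hcfc⟩ := isUnit_add_smul_one_and_smul_fracPow_comp_inverse hA hpos hr
    ((∏ k, t k ^ (a k / (l k : ℝ))) * (∏ k, |ξ k| ^ (a k)) * h ^ (-μ))
    (1 - (∑ k, a k / (l k : ℝ)) - μ)
  refine ⟨hunit, ?_⟩
  rw [hcfc]
  refine norm_cfc_le zero_le_one fun s hs => ?_
  have hs0 := hpos s hs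
  have hb : (∏ k, t k ^ (a k / (l k : ℝ))) * (∏ k, |ξ k| ^ (a k)) * h ^ (-μ) =
      (∏ k, (t k * |ξ k| ^ l k) ^ (a k / (l k : ℝ))) * h⁻¹ ^ μ := by
    rw [← Finset.prod_mul_distrib, Real.rpow_neg hh.le, Real.inv_rpow hh.le]
    congr 1
    refine Finset.prod_congr rfl fun k _ => ?_
    have hlk : (l k : ℝ) ≠ 0 := Nat.cast_ne_zero.2 (hl k).ne'
    rw [Real.mul_rpow (ht k).le (pow_nonneg (abs_nonneg _) _), ← Real.rpow_natCast,
      ← Real.rpow_mul (abs_nonneg _), mul_div_cancel₀ _ hlk]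
  have hprod : 0 ≤ ∏ k, (t k * |ξ k| ^ l k) ^ (a k / (l k : ℝ)) :=
    Finset.prod_nonneg fun k _ => Real.rpow_nonneg (hz k) _
  rw [hb, Real.norm_of_nonneg (by positivity), ← mul_assoc, ← div_eq_mul_inv,
    div_le_one (by positivity)]
  exact prod_rpow_mul_rpow_mul_rpow_le hw hz hμ0 hμ1 (inv_nonneg.2 hh.le) hs0.le
end

section
/- Let 0 ≤ φ < π, let l₁,…,lₙ be positive integers and let c > 0. There exists a constant C > 0 such that for every λ ∈ S_φ, every real a ≥ 0, every ξ ∈ ℝⁿ, every t ∈ (0,∞)ⁿ, every k ∈ {1,…,n} and every integer 0 ≤ i ≤ 2lₖ: tₖ^{i/(2lₖ)} |λ|^{1−i/(2lₖ)} |ξₖ|^{i} ≤ C |a + λ + Σⱼ tⱼ ξⱼ^{2lⱼ}|. -/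
/-- The sector `S_φ = {λ ∈ ℂ : |arg λ| ≤ φ} ∪ {0}`. -/
def Sector (φ : ℝ) : Set ℂ := {z | z = 0 ∨ |z.arg| ≤ φ}

theorem Sector.norm_mul_cos_le_re {φ : ℝ} (hφπ : φ ≤ Real.pi) {z : ℂ} (hz : z ∈ Sector φ) :
    ‖z‖ * Real.cos φ ≤ z.re := by
  rcases hz with rfl | hz
  · simp
  · rw [← Complex.norm_mul_cos_arg z, ← Real.cos_abs z.arg]
    exact mul_le_mul_of_nonneg_left
      (Real.cos_le_cos_of_nonneg_of_le_pi (abs_nonneg _) hφπ hz) (norm_nonneg z)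

/-- On a sector, adding a nonnegative real number cannot produce much cancellation. -/
theorem Sector.cos_half_mul_norm_add_le {φ : ℝ} (hφπ : φ ≤ Real.pi) {z : ℂ}
    (hz : z ∈ Sector φ) {r : ℝ} (hr : 0 ≤ r) :
    Real.cos (φ / 2) * (‖z‖ + r) ≤ ‖z + (r : ℂ)‖ := by
  have hre := Sector.norm_mul_cos_le_re hφπ hz
  have hcos : Real.cos φ = 2 * Real.cos (φ / 2) ^ 2 - 1 := by
    rw [← Real.cos_two_mul, mul_div_cancel₀ φ two_ne_zero]
  have hnorm : ‖z + (r : ℂ)‖ ^ 2 = ‖z‖ ^ 2 + 2 * r * z.re + r ^ 2 := by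
    simp only [Complex.sq_norm, Complex.normSq_apply, Complex.add_re, Complex.add_im,
      Complex.ofReal_re, Complex.ofReal_im]
    ring
  refine le_of_sq_le_sq ?_ (norm_nonneg _)
  rw [hnorm]
  rw [hcos] at hre
  nlinarith [mul_le_mul_of_nonneg_left hre hr,
    mul_nonneg (sub_nonneg.2 (Real.cos_sq_le_one (φ / 2))) (sq_nonneg (‖z‖ - r))]

theorem rpow_mul_rpow_mul_abs_pow_le_add {t x : ℝ} (ht : 0 ≤ t) (hx : 0 ≤ x) (y : ℝ)
    {m i : ℕ} (hm : 0 < m) (hi : i ≤ 2 * m) :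
    t ^ ((i : ℝ) / (2 * m)) * x ^ (1 - (i : ℝ) / (2 * m)) * |y| ^ i ≤ x + t * y ^ (2 * m) := by
  have hm' : (0 : ℝ) < 2 * m := by positivity
  set θ : ℝ := (i : ℝ) / (2 * m) with hθ
  have hθ0 : 0 ≤ θ := by positivity
  have hθ1 : θ ≤ 1 := (div_le_one hm').2 (by exact_mod_cast hi)
  have hy : y ^ (2 * m) = |y| ^ (2 * m) := ((even_two_mul m).pow_abs y).symm
  have hs : 0 ≤ t * y ^ (2 * m) := hy ▸ by positivity
  have hyi : (y ^ (2 * m)) ^ θ = |y| ^ i := by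
    rw [hy, ← Real.rpow_natCast |y| (2 * m), ← Real.rpow_mul (abs_nonneg y),
      ← Real.rpow_natCast |y| i, hθ]
    push_cast
    rw [mul_div_cancel₀ _ hm'.ne']
  calc t ^ θ * x ^ (1 - θ) * |y| ^ i
      = (t * y ^ (2 * m)) ^ θ * x ^ (1 - θ) := by
        rw [Real.mul_rpow ht (hy ▸ by positivity), hyi]
        ring
    _ ≤ θ * (t * y ^ (2 * m)) + (1 - θ) * x :=
        Real.geom_mean_le_arith_mean2_weighted hθ0 (sub_nonneg.2 hθ1) hs hx (by ring)
    _ ≤ x + t * y ^ (2 * m) := by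
        nlinarith [mul_nonneg (sub_nonneg.2 hθ1) hs, mul_nonneg hθ0 hx]

/-- Scalar symbol estimate underlying (5.9)–(5.12): for `λ ∈ S_φ`, `a ≥ 0`, `ξ ∈ ℝⁿ`,
`t ∈ (0,∞)ⁿ`, `k` and `0 ≤ i ≤ 2 l k`:
`t k ^ (i / (2 l k)) * |λ| ^ (1 - i / (2 l k)) * |ξ k| ^ i ≤ C * |a + λ + ∑ j, t j * ξ j ^ (2 l j)|`. -/
theorem scalar_resolvent_symbol_estimate (φ : ℝ) (hφ0 : 0 ≤ φ) (hφπ : φ < Real.pi)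
    (n : ℕ) (l : Fin n → ℕ) (hl : ∀ k, 0 < l k) :
    ∃ C : ℝ, 0 < C ∧ ∀ z : ℂ, z ∈ Sector φ → ∀ a : ℝ, 0 ≤ a → ∀ ξ : Fin n → ℝ,
      ∀ t : Fin n → ℝ, (∀ j, 0 < t j) → ∀ k : Fin n, ∀ i : ℕ, i ≤ 2 * l k →
      t k ^ ((i : ℝ) / (2 * l k)) * ‖z‖ ^ (1 - (i : ℝ) / (2 * l k)) * |ξ k| ^ i
        ≤ C * ‖(a : ℂ) + z + ((∑ j, t j * ξ j ^ (2 * l j) : ℝ) : ℂ)‖ := by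
  have hcos : 0 < Real.cos (φ / 2) :=
    Real.cos_pos_of_mem_Ioo ⟨by linarith [Real.pi_pos], by linarith⟩
  refine ⟨(Real.cos (φ / 2))⁻¹, inv_pos.2 hcos, fun z hz a ha ξ t ht k i hi => ?_⟩
  have hterm : ∀ j, 0 ≤ t j * ξ j ^ (2 * l j) := fun j =>
    mul_nonneg (ht j).le ((even_two_mul (l j)).pow_nonneg (ξ j))
  have hle : t k * ξ k ^ (2 * l k) ≤ ∑ j, t j * ξ j ^ (2 * l j) :=
    Finset.single_le_sum (fun j _ => hterm j) (Finset.mem_univ k)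
  have hsector := Sector.cos_half_mul_norm_add_le hφπ.le hz
    (add_nonneg ha ((hterm k).trans hle))
  rw [Complex.ofReal_add, add_left_comm z, ← add_assoc (a : ℂ)] at hsector
  refine (rpow_mul_rpow_mul_abs_pow_le_add (ht k).le (norm_nonneg z) (ξ k) (hl k) hi).trans ?_
  rw [inv_mul_eq_div, le_div_iff₀' hcos]
  refine (mul_le_mul_of_nonneg_left ?_ hcos.le).trans hsector
  linarith
end

section
/- Let H be a complex Hilbert space, A : H → H a bounded selfadjoint operator with ⟨Au,u⟩ ≥ c‖u‖² (c > 0), let l₁,…,lₙ be positive integers and 0 ≤ φ < π. There exists M > 0 such that for every λ ∈ S_φ, every ξ ∈ ℝⁿ, every t ∈ (0,∞)ⁿ and every k: 2 lₖ tₖ ξₖ^{2lₖ} ‖((A + (λ + Σⱼ tⱼ ξⱼ^{2lⱼ})·I)^{−1})²‖_{L(H)} ≤ M. -/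
theorem Sector.cos_mul_norm_le_re {φ : ℝ} (hφπ : φ ≤ Real.pi) {z : ℂ} (hz : z ∈ Sector φ) :
    Real.cos φ * ‖z‖ ≤ z.re := by
  rcases hz with rfl | hz
  · simp
  · have hcos : Real.cos φ ≤ Real.cos z.arg := by
      rw [← Real.cos_abs z.arg]
      exact Real.cos_le_cos_of_nonneg_of_le_pi (abs_nonneg _) hφπ hz
    calc Real.cos φ * ‖z‖ ≤ Real.cos z.arg * ‖z‖ := by gcongr
      _ = z.re := by rw [mul_comm, Complex.norm_mul_cos_arg]

theorem Complex.sqrt_mul_le_norm_ofReal_add {q r : ℝ} (hq : -1 ≤ q) (hq1 : q ≤ 1) (hr : 0 ≤ r)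
    {z : ℂ} (hz : q * ‖z‖ ≤ z.re) : √((1 + q) / 2) * r ≤ ‖(r : ℂ) + z‖ := by
  have hδ : √((1 + q) / 2) ^ 2 = (1 + q) / 2 := Real.sq_sqrt (by linarith)
  have hnorm : ‖(r : ℂ) + z‖ ^ 2 = r ^ 2 + 2 * r * z.re + ‖z‖ ^ 2 := by
    rw [Complex.sq_norm, Complex.sq_norm, Complex.normSq_apply, Complex.normSq_apply]
    simp only [Complex.add_re, Complex.add_im, Complex.ofReal_re, Complex.ofReal_im]
    ring
  refine le_of_sq_le_sq ?_ (norm_nonneg _)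
  rw [mul_pow, hδ, hnorm]
  have hz0 := norm_nonneg z
  have hrz := mul_le_mul_of_nonneg_left hz hr
  have hsq := mul_nonneg (sub_nonneg.2 hq1) (sq_nonneg (r - ‖z‖))
  have hcross := mul_nonneg (by linarith : 0 ≤ 1 + q) (mul_nonneg hr hz0)
  have hlast := mul_nonneg (by linarith : 0 ≤ 1 + q) (sq_nonneg ‖z‖)
  nlinarith

theorem ContinuousLinearMap.norm_ringInverse_le_of_forall_le_norm_inner {H : Type*}
    [NormedAddCommGroup H] [InnerProductSpace ℂ H] [CompleteSpace H] (T : H →L[ℂ] H) {m : ℝ}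
    (hm : 0 < m) (h : ∀ u : H, m * ‖u‖ ^ 2 ≤ ‖inner ℂ (T u) u‖) :
    ‖Ring.inverse T‖ ≤ m⁻¹ := by
  have hunit : IsUnit T := T.isUnit_of_forall_le_norm_inner_map (c := ⟨m, hm.le⟩) hm fun u ↦
    (mul_comm _ _).trans_le (h u)
  refine ContinuousLinearMap.opNorm_le_bound _ (inv_nonneg.2 hm.le) fun v ↦ ?_
  set u := Ring.inverse T v
  have hTu : T u = v := congrArg (fun S : H →L[ℂ] H ↦ S v) (Ring.mul_inverse_cancel T hunit)
  rw [inv_mul_eq_div, le_div_iff₀ hm]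
  have hbound : m * ‖u‖ ^ 2 ≤ ‖v‖ * ‖u‖ := (h u).trans (hTu ▸ norm_inner_le_norm (T u) u)
  rcases (norm_nonneg u).eq_or_lt with h0 | h0
  · simp [← h0]
  · exact le_of_mul_le_mul_right (by linarith) h0

theorem norm_ringInverse_add_smul_one_le {H : Type*} [NormedAddCommGroup H]
    [InnerProductSpace ℂ H] [CompleteSpace H] (A : H →L[ℂ] H) (hA : IsSelfAdjoint A) {c : ℝ}
    (hc : 0 < c) (hcoer : ∀ u : H, c * ‖u‖ ^ 2 ≤ (inner ℂ (A u) u : ℂ).re) {q : ℝ}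
    (hq : -1 < q) (hq1 : q ≤ 1) {z : ℂ} (hz : q * ‖z‖ ≤ z.re) {s : ℝ} (hs : 0 ≤ s) :
    ‖Ring.inverse (A + (z + (s : ℂ)) • (1 : H →L[ℂ] H))‖ ≤ (√((1 + q) / 2) * (c + s))⁻¹ := by
  have hδ : 0 < √((1 + q) / 2) := Real.sqrt_pos.2 (by linarith)
  refine ContinuousLinearMap.norm_ringInverse_le_of_forall_le_norm_inner _ (by positivity)
    fun u ↦ ?_
  set a := (inner ℂ (A u) u : ℂ).re
  have hreal : (inner ℂ (A u) u : ℂ) = (a : ℂ) :=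
    (hA.isSymmetric.coe_re_inner_apply_self u).symm
  have hinner : inner ℂ ((A + (z + (s : ℂ)) • (1 : H →L[ℂ] H)) u) u =
      ((a + s * ‖u‖ ^ 2 : ℝ) : ℂ) + (starRingEnd ℂ) z * ((‖u‖ ^ 2 : ℝ) : ℂ) := by
    simp only [add_apply, smul_apply, one_apply_eq_self, inner_add_left, inner_smul_left, hreal,
      inner_self_eq_norm_sq_to_K, map_add, Complex.conj_ofReal]
    push_cast
    simp only [Complex.coe_algebraMap]
    ring
  have hcu := hcoer u
  rw [hinner, mul_assoc]
  refine le_trans ?_ (Complex.sqrt_mul_le_norm_ofReal_add hq.le hq1 ?_ ?_)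
  · gcongr
    linarith
  · have : 0 ≤ c * ‖u‖ ^ 2 := by positivity
    have : 0 ≤ s * ‖u‖ ^ 2 := by positivity
    linarith
  · rw [norm_mul, RCLike.norm_conj, Complex.norm_real, Real.norm_of_nonneg (by positivity),
      Complex.re_mul_ofReal, Complex.conj_re, ← mul_assoc]
    gcongr

/-- Estimate (5.10): for `λ ∈ S_φ`, `ξ ∈ ℝⁿ`, `t ∈ (0,∞)ⁿ` and every `k`:
`2 l k * t k * ξ k ^ (2 l k) * ‖((A + (λ + ∑ j, t j ξ j ^ (2 l j)) • I)⁻¹)²‖ ≤ M`. -/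
theorem resolvent_square_estimate {H : Type*} [NormedAddCommGroup H] [InnerProductSpace ℂ H]
    [CompleteSpace H] (A : H →L[ℂ] H) (hA : IsSelfAdjoint A) (c : ℝ) (hc : 0 < c)
    (hcoer : ∀ u : H, c * ‖u‖ ^ 2 ≤ (inner ℂ (A u) u : ℂ).re)
    (n : ℕ) (l : Fin n → ℕ) (hl : ∀ k, 0 < l k)
    (φ : ℝ) (hφ0 : 0 ≤ φ) (hφπ : φ < Real.pi) :
    ∃ M : ℝ, 0 < M ∧ ∀ z : ℂ, z ∈ Sector φ → ∀ ξ : Fin n → ℝ,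
      ∀ t : Fin n → ℝ, (∀ j, 0 < t j) → ∀ k : Fin n,
      2 * (l k : ℝ) * t k * ξ k ^ (2 * l k) *
        ‖(Ring.inverse (A + (z + ((∑ j, t j * ξ j ^ (2 * l j) : ℝ) : ℂ)) •
            (1 : H →L[ℂ] H))) ^ 2‖ ≤ M := by
  have hq : -1 < Real.cos φ := by
    rw [← Real.cos_pi]
    exact Real.cos_lt_cos_of_nonneg_of_le_pi hφ0 le_rfl hφπ
  have hδ : 0 < √((1 + Real.cos φ) / 2) := Real.sqrt_pos.2 (by linarith)
  set δ := √((1 + Real.cos φ) / 2)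
  refine ⟨2 * (∑ j, (l j : ℝ) + 1) / (δ ^ 2 * c), by positivity, fun z hz ξ t ht k ↦ ?_⟩
  have hterm : ∀ j, 0 ≤ t j * ξ j ^ (2 * l j) := fun j ↦
    mul_nonneg (ht j).le ((even_two_mul _).pow_nonneg _)
  set s := ∑ j, t j * ξ j ^ (2 * l j)
  have hs : 0 ≤ s := Finset.sum_nonneg fun j _ ↦ hterm j
  have hks : t k * ξ k ^ (2 * l k) ≤ s :=
    Finset.single_le_sum (fun j _ ↦ hterm j) (Finset.mem_univ k)
  have hlk : (l k : ℝ) ≤ ∑ j, (l j : ℝ) + 1 :=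
    (Finset.single_le_sum (f := fun j ↦ (l j : ℝ)) (fun j _ ↦ Nat.cast_nonneg _)
      (Finset.mem_univ k)).trans (by linarith)
  have hres := norm_ringInverse_add_smul_one_le A hA hc hcoer hq (Real.cos_le_one φ)
    (Sector.cos_mul_norm_le_re hφπ.le hz) hs
  set R := Ring.inverse (A + (z + (s : ℂ)) • (1 : H →L[ℂ] H))
  have hR : ‖R ^ 2‖ ≤ ((δ * (c + s))⁻¹) ^ 2 :=
    (norm_pow_le' R two_pos).trans (by gcongr)
  calc 2 * (l k : ℝ) * t k * ξ k ^ (2 * l k) * ‖R ^ 2‖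
      = 2 * l k * (t k * ξ k ^ (2 * l k)) * ‖R ^ 2‖ := by ring
    _ ≤ 2 * (∑ j, (l j : ℝ) + 1) * s * ((δ * (c + s))⁻¹) ^ 2 := by
        gcongr
        exact hterm k
    _ = 2 * (∑ j, (l j : ℝ) + 1) / δ ^ 2 * (s / (c + s) ^ 2) := by
        field_simp
    _ ≤ 2 * (∑ j, (l j : ℝ) + 1) / δ ^ 2 * (1 / c) := by
        gcongr ?_ * ?_
        rw [div_le_div_iff₀ (by positivity) hc]
        nlinarith [mul_nonneg hc.le hs, sq_nonneg c, sq_nonneg s]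
    _ = 2 * (∑ j, (l j : ℝ) + 1) / (δ ^ 2 * c) := by field_simp
end

section
/- Let H be a complex Hilbert space, A : H → H a bounded selfadjoint operator with ⟨Au,u⟩ ≥ c‖u‖² (c > 0), let l₁,…,lₙ be positive integers and 0 ≤ φ < π. Then for every f ∈ S(ℝⁿ; H), every λ ∈ S_φ and every t ∈ (0,∞)ⁿ there exists a unique u ∈ S(ℝⁿ; H) satisfying Σₖ (−1)^{lₖ} tₖ ∂ₖ^{2lₖ} u(x) + A(u(x)) + λ u(x) = f(x) for all x ∈ ℝⁿ. -/
noncomputable section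

/-- `i`-th classical partial derivative in the `k`-th coordinate of a Schwartz function. -/
def pdIter (n : ℕ) {H : Type*} [NormedAddCommGroup H] [NormedSpace ℝ H] (k : Fin n)
    (i : ℕ) (u : SchwartzMap (Fin n → ℝ) H) : SchwartzMap (Fin n → ℝ) H :=
  (fun v => LineDeriv.lineDerivOpCLM ℝ (SchwartzMap (Fin n → ℝ) H) (Pi.single k 1 : Fin n → ℝ) v)^[i] u

open scoped FourierTransform SchwartzMap ContDiff LineDeriv
open SchwartzMap

/-- The iterated derivatives of `s ↦ (a + s)⁻¹` on the half-line. -/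
theorem iteratedDerivWithin_ringInverse_add_smul_one {R : Type*} [NormedRing R]
    [NormedAlgebra ℝ R] [CompleteSpace R] (a : R)
    (ha : ∀ s ∈ Set.Ici (0 : ℝ), IsUnit (a + s • (1 : R))) (m : ℕ) :
    ∀ s ∈ Set.Ici (0 : ℝ),
      iteratedDerivWithin m (fun s : ℝ ↦ Ring.inverse (a + s • (1 : R))) (Set.Ici 0) s =
        ((-1 : ℝ) ^ m * (m.factorial : ℝ)) • Ring.inverse (a + s • (1 : R)) ^ (m + 1) := by
  have hderiv : ∀ s ∈ Set.Ici (0 : ℝ),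
      HasDerivAt (fun s : ℝ ↦ Ring.inverse (a + s • (1 : R)))
        (-Ring.inverse (a + s • (1 : R)) ^ 2) s := by
    intro s hs
    obtain ⟨v, hv⟩ := ha s hs
    have h₁ : HasDerivAt (fun s : ℝ ↦ a + s • (1 : R)) (1 : R) s := by
      simpa using ((hasDerivAt_id s).smul_const (1 : R)).const_add a
    have h₂ := hasFDerivAt_ringInverse (𝕜 := ℝ) v
    rw [hv] at h₂
    have h₃ := h₂.comp_hasDerivAt s h₁
    rw [← hv, Ring.inverse_unit]
    simpa [pow_two, Function.comp_def] using h₃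
  induction m with
  | zero => intro s _; simp
  | succ m ih =>
    intro s hs
    have huniq : UniqueDiffWithinAt ℝ (Set.Ici (0 : ℝ)) s := uniqueDiffOn_Ici 0 s hs
    rw [iteratedDerivWithin_succ, derivWithin_congr ih (ih s hs)]
    have hpow : ∀ j : ℕ, HasDerivAt (fun s : ℝ ↦ Ring.inverse (a + s • (1 : R)) ^ (j + 1))
        (-((j : ℝ) + 1) • Ring.inverse (a + s • (1 : R)) ^ (j + 2)) s := by
      intro j
      induction j with
      | zero => simpa using hderiv s hs
      | succ j hj =>
        simp only [pow_succ _ (j + 1)]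
        convert hj.fun_mul (hderiv s hs) using 1
        rw [mul_neg, ← pow_add, smul_mul_assoc, ← pow_succ]
        push_cast
        module
    rw [((hpow m).fun_const_smul ((-1 : ℝ) ^ m * (m.factorial : ℝ))).hasDerivWithinAt.derivWithin
      huniq, smul_smul]
    congr 1
    rw [Nat.factorial_succ]
    push_cast
    ring

/-- If `a + s` is invertible with uniformly bounded inverse for all `s ≥ 0`, then
`x ↦ (a + p x)⁻¹` has temperate growth for every nonnegative `p` of temperate growth. -/
theorem hasTemperateGrowth_ringInverse_add_smul_one {R V : Type*} [NormedRing R]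
    [NormedAlgebra ℝ R] [CompleteSpace R] [NormedAddCommGroup V] [NormedSpace ℝ V] (a : R)
    (ha : ∀ s : ℝ, 0 ≤ s → IsUnit (a + s • (1 : R))) (K : ℝ)
    (hK : ∀ s : ℝ, 0 ≤ s → ‖Ring.inverse (a + s • (1 : R))‖ ≤ K) {p : V → ℝ}
    (hp : p.HasTemperateGrowth) (hp₀ : ∀ x, 0 ≤ p x) :
    (fun x ↦ Ring.inverse (a + p x • (1 : R))).HasTemperateGrowth := by
  have hK₀ : 0 ≤ K := (norm_nonneg _).trans (hK 0 le_rfl)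
  refine Function.HasTemperateGrowth.comp' (g := fun s : ℝ ↦ Ring.inverse (a + s • (1 : R)))
    (t := Set.Ici 0) (Set.range_subset_iff.2 hp₀) (uniqueDiffOn_Ici 0) ?_ ?_ hp
  · intro s hs
    obtain ⟨v, hv⟩ := ha s hs
    have h₁ : ContDiffAt ℝ ∞ Ring.inverse (a + s • (1 : R)) := hv ▸ contDiffAt_ringInverse ℝ v
    have h₂ : ContDiffAt ℝ ∞ (fun s : ℝ ↦ a + s • (1 : R)) s := by fun_prop
    exact (ContDiffAt.comp s h₁ h₂).contDiffWithinAt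
  · intro N
    refine ⟨0, ∑ m ∈ Finset.range (N + 1), (m.factorial : ℝ) * K ^ (m + 1), by positivity, ?_⟩
    intro m hm s hs
    rw [norm_iteratedFDerivWithin_eq_norm_iteratedDerivWithin,
      iteratedDerivWithin_ringInverse_add_smul_one a ha m s hs, norm_smul, pow_zero, mul_one]
    calc ‖(-1 : ℝ) ^ m * (m.factorial : ℝ)‖ * ‖Ring.inverse (a + s • (1 : R)) ^ (m + 1)‖
        ≤ (m.factorial : ℝ) * K ^ (m + 1) := by
          gcongr
          · simp
          · exact (norm_pow_le' _ m.succ_pos).trans (by gcongr; exact hK s hs)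
      _ ≤ _ := Finset.single_le_sum (f := fun m ↦ (m.factorial : ℝ) * K ^ (m + 1))
          (fun _ _ ↦ by positivity) (Finset.mem_range.2 (by lia))

/-- For `z` in a sector of angle less than `π`, the numerical range of `A + z + s` stays away from
`0`, uniformly in `s ≥ 0`. -/
theorem exists_le_norm_inner_add_sector {H : Type*} [NormedAddCommGroup H]
    [InnerProductSpace ℂ H] [CompleteSpace H] {A : H →L[ℂ] H} (hA : IsSelfAdjoint A) {c : ℝ}
    (hc : 0 < c) (hcoer : ∀ u : H, c * ‖u‖ ^ 2 ≤ (inner ℂ (A u) u : ℂ).re) {φ : ℝ}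
    (hφ : φ < Real.pi) {z : ℂ} (hz : z ∈ Sector φ) :
    ∃ δ : NNReal, 0 < δ ∧ ∀ s : ℝ, 0 ≤ s → ∀ v : H,
      ‖v‖ ^ 2 * δ ≤ ‖inner ℂ ((A + z • (1 : H →L[ℂ] H) + s • (1 : H →L[ℂ] H)) v) v‖ := by
  have hexp : ∀ (s : ℝ) (v : H),
      inner ℂ ((A + z • (1 : H →L[ℂ] H) + s • (1 : H →L[ℂ] H)) v) v =
        inner ℂ (A v) v + (starRingEnd ℂ z + s) * ((‖v‖ ^ 2 : ℝ) : ℂ) := by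
    intro s v
    have happ : (A + z • (1 : H →L[ℂ] H) + s • (1 : H →L[ℂ] H)) v = A v + z • v + (s : ℂ) • v := by
      simp
    rw [happ, inner_add_left, inner_add_left, inner_smul_left, inner_smul_left,
      inner_self_eq_norm_sq_to_K, Complex.conj_ofReal]
    simp only [Complex.ofReal_pow, Complex.coe_algebraMap]
    ring
  by_cases him : z.im = 0
  · have hre : 0 ≤ z.re := by
      by_contra! hneg
      have harg : z.arg = Real.pi := Complex.arg_eq_pi_iff.2 ⟨hneg, him⟩
      rcases hz with rfl | hz
      · simp at hneg
      · rw [harg, abs_of_pos Real.pi_pos] at hz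
        linarith
    refine ⟨⟨c, hc.le⟩, hc, fun s hs v ↦ ?_⟩
    refine le_trans ?_ (Complex.re_le_norm _)
    rw [hexp, Complex.add_re, Complex.re_mul_ofReal]
    have h₁ := hcoer v
    have h₂ : 0 ≤ (starRingEnd ℂ z + s : ℂ).re * ‖v‖ ^ 2 := by
      simp only [Complex.add_re, Complex.conj_re, Complex.ofReal_re]
      positivity
    change ‖v‖ ^ 2 * c ≤ _
    linarith
  · refine ⟨⟨|z.im|, abs_nonneg _⟩, abs_pos.2 him, fun s _ v ↦ ?_⟩
    refine le_trans ?_ (Complex.abs_im_le_norm _)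
    have h₁ : (inner ℂ (A v) v : ℂ).im = 0 :=
      Complex.conj_eq_iff_im.1 (by
        rw [inner_conj_symm]
        exact (hA.isSymmetric v v).symm)
    rw [hexp, Complex.add_im, Complex.im_mul_ofReal, h₁]
    simp only [Complex.add_im, Complex.conj_im, Complex.ofReal_im, add_zero, zero_add, abs_mul,
      abs_neg, abs_of_nonneg (sq_nonneg ‖v‖)]
    exact (mul_comm _ _).le

/-- A bounded operator `T` with `δ ‖v‖² ≤ |⟨T v, v⟩|` has inverse of norm at most `δ⁻¹`. -/
theorem norm_ringInverse_le_of_le_norm_inner {H : Type*} [NormedAddCommGroup H]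
    [InnerProductSpace ℂ H] [CompleteSpace H] {T : H →L[ℂ] H} {δ : NNReal} (hδ : 0 < δ)
    (h : ∀ v, ‖v‖ ^ 2 * δ ≤ ‖inner ℂ (T v) v‖) : ‖Ring.inverse T‖ ≤ (δ : ℝ)⁻¹ := by
  have hT := T.isUnit_of_forall_le_norm_inner_map hδ h
  refine ContinuousLinearMap.opNorm_le_bound _ (by positivity) fun w ↦ ?_
  have hw : T (Ring.inverse T w) = w := by
    rw [← mul_apply_eq_comp, Ring.mul_inverse_cancel T hT,
      one_apply_eq_self]
  have hanti := (ContinuousLinearMap.antilipschitz_of_forall_le_inner_map T hδ h).le_mul_dist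
    (Ring.inverse T w) 0
  simpa [hw] using hanti

/-- The Fourier transform commutes with postcomposition by a bounded operator. -/
theorem SchwartzMap.fourier_postcompCLM {V E F : Type*} [NormedAddCommGroup V]
    [InnerProductSpace ℝ V] [FiniteDimensional ℝ V] [MeasurableSpace V] [BorelSpace V]
    [NormedAddCommGroup E] [NormedSpace ℂ E] [CompleteSpace E] [NormedAddCommGroup F]
    [NormedSpace ℂ F] [CompleteSpace F] (L : E →L[ℂ] F) (u : 𝓢(V, E)) :
    𝓕 (u.postcompCLM L) = (𝓕 u).postcompCLM L := by
  ext ξ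
  rw [postcompCLM_apply, fourier_coe, fourier_coe, Real.fourier_eq, Real.fourier_eq,
    ← L.integral_comp_comm ((Real.fourierIntegral_convergent_iff ξ).2 u.integrable)]
  simp [Circle.smul_def]

/-- The Fourier transform of an iterated directional derivative. -/
theorem SchwartzMap.fourier_iterate_lineDerivOp_apply {V E : Type*} [NormedAddCommGroup V]
    [InnerProductSpace ℝ V] [FiniteDimensional ℝ V] [MeasurableSpace V] [BorelSpace V]
    [NormedAddCommGroup E] [NormedSpace ℂ E] (m : V) (i : ℕ) (u : 𝓢(V, E)) (ξ : V) :
    𝓕 (∂_{m}^[i] u) ξ = ((2 * Real.pi * Complex.I) * (inner ℝ ξ m : ℝ)) ^ i • 𝓕 u ξ := by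
  induction i with
  | zero => simp
  | succ i ih =>
    have hm : (inner ℝ · m : V → ℝ).HasTemperateGrowth := by fun_prop
    rw [Function.iterate_succ_apply', fourier_lineDerivOp_eq, smul_apply,
      smulLeftCLM_apply_apply hm, ih, pow_succ', mul_smul _ (_ ^ i),
      mul_smul (2 * Real.pi * Complex.I), Complex.coe_smul]

/-- Iterated partial derivatives after the change of variables to Euclidean space. -/
theorem pdIter_compCLMOfContinuousLinearEquiv (n : ℕ) {H V : Type*} [NormedAddCommGroup H]
    [NormedSpace ℂ H] [NormedAddCommGroup V] [NormedSpace ℝ V] (e : (Fin n → ℝ) ≃L[ℝ] V)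
    (k : Fin n) (i : ℕ) (u : 𝓢(V, H)) :
    pdIter n k i (compCLMOfContinuousLinearEquiv ℂ e u) =
      compCLMOfContinuousLinearEquiv ℂ e (∂_{e (Pi.single k 1)}^[i] u) := by
  induction i with
  | zero => rfl
  | succ i ih =>
    rw [pdIter, Function.iterate_succ_apply', Function.iterate_succ_apply',
      ← lineDerivOp_compCLMOfContinuousLinearEquiv, ← ih]
    rfl

/-- Unique solvability in the Schwartz space of
`∑ k, (-1)^(l k) t k ∂_{m k}^(2 l k) u + A u + z u = f` for directions `m k`, provided that the
numerical range of `A + z + s` stays away from `0` uniformly in `s ≥ 0`. -/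
theorem existsUnique_schwartz_sum_lineDerivOp_add {H V ι : Type*} [Fintype ι]
    [NormedAddCommGroup H] [InnerProductSpace ℂ H] [CompleteSpace H] [NormedAddCommGroup V]
    [InnerProductSpace ℝ V] [FiniteDimensional ℝ V] [MeasurableSpace V] [BorelSpace V]
    (A : H →L[ℂ] H) (z : ℂ) {δ : NNReal} (hδ : 0 < δ)
    (hlow : ∀ s : ℝ, 0 ≤ s → ∀ v : H,
      ‖v‖ ^ 2 * δ ≤ ‖inner ℂ ((A + z • (1 : H →L[ℂ] H) + s • (1 : H →L[ℂ] H)) v) v‖)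
    (m : ι → V) (l : ι → ℕ) (t : ι → ℝ) (ht : ∀ k, 0 ≤ t k) (f : 𝓢(V, H)) :
    ∃! u : 𝓢(V, H),
      (∑ k, ((-1 : ℝ) ^ l k * t k) • ∂_{m k}^[2 * l k] u) + u.postcompCLM A + z • u = f := by
  set p : V → ℝ := fun ξ ↦ ∑ k, t k * (2 * Real.pi * inner ℝ ξ (m k)) ^ (2 * l k)
  have hp : p.HasTemperateGrowth := by fun_prop
  have hp₀ : ∀ ξ, 0 ≤ p ξ := fun ξ ↦
    Finset.sum_nonneg fun k _ ↦ mul_nonneg (ht k) (Even.pow_nonneg (even_two_mul _) _)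
  set B : H →L[ℂ] H := A + z • (1 : H →L[ℂ] H)
  have hunit : ∀ s : ℝ, 0 ≤ s → IsUnit (B + s • (1 : H →L[ℂ] H)) := fun s hs ↦
    ContinuousLinearMap.isUnit_of_forall_le_norm_inner_map _ hδ (hlow s hs)
  have hR : (fun ξ ↦ Ring.inverse (B + p ξ • (1 : H →L[ℂ] H))).HasTemperateGrowth :=
    hasTemperateGrowth_ringInverse_add_smul_one B hunit (δ : ℝ)⁻¹
      (fun s hs ↦ norm_ringInverse_le_of_le_norm_inner hδ (hlow s hs)) hp hp₀
  have hsymbol : ∀ (u : 𝓢(V, H)) (ξ : V),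
      𝓕 ((∑ k, ((-1 : ℝ) ^ l k * t k) • ∂_{m k}^[2 * l k] u) + u.postcompCLM A + z • u) ξ =
        (B + p ξ • (1 : H →L[ℂ] H)) (𝓕 u ξ) := by
    intro u ξ
    have hterm : ∀ k, 𝓕 (((-1 : ℝ) ^ l k * t k) • ∂_{m k}^[2 * l k] u) ξ =
        (t k * (2 * Real.pi * inner ℝ ξ (m k)) ^ (2 * l k)) • 𝓕 u ξ := by
      intro k
      rw [FourierTransform.fourier_smul, smul_apply, fourier_iterate_lineDerivOp_apply,
        ← Complex.coe_smul, ← Complex.coe_smul, smul_smul]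
      congr 1
      have hI : (2 * Real.pi * Complex.I * (inner ℝ ξ (m k) : ℝ)) ^ (2 * l k) =
          (-1 : ℂ) ^ l k * (2 * Real.pi * (inner ℝ ξ (m k) : ℝ)) ^ (2 * l k) := by
        rw [mul_right_comm, mul_pow, pow_mul Complex.I, Complex.I_sq, mul_comm]
      have hsign : (-1 : ℂ) ^ l k * (-1) ^ l k = 1 := by
        rw [← mul_pow]
        simp
      rw [hI]
      push_cast
      linear_combination
        (t k * (2 * Real.pi * (inner ℝ ξ (m k) : ℝ)) ^ (2 * l k) : ℂ) * hsign
    rw [FourierTransform.fourier_add, FourierTransform.fourier_add,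
      FourierTransform.fourier_sum, FourierTransform.fourier_smul, fourier_postcompCLM]
    simp only [add_apply, sum_apply, hterm, smul_apply, postcompCLM_apply]
    rw [← Finset.sum_smul]
    simp only [B, _root_.add_apply, _root_.smul_apply, one_apply_eq_self]
    abel
  have hinj : ∀ v w : 𝓢(V, H), (∀ ξ, 𝓕 v ξ = 𝓕 w ξ) → v = w := by
    intro v w h
    have hv : 𝓕⁻ (𝓕 v) = v := FourierTransform.fourierInv_fourier_eq v
    have hw : 𝓕⁻ (𝓕 w) = w := FourierTransform.fourierInv_fourier_eq w
    rw [← hv, ← hw, SchwartzMap.ext h]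
  set g : 𝓢(V, H) := bilinLeftCLM (ContinuousLinearMap.apply ℂ H) hR (𝓕 f)
  have hg : ∀ ξ, 𝓕 (𝓕⁻ g) ξ = Ring.inverse (B + p ξ • (1 : H →L[ℂ] H)) (𝓕 f ξ) := by
    intro ξ
    rw [FourierTransform.fourier_fourierInv_eq]
    rfl
  refine ⟨𝓕⁻ g, hinj _ _ fun ξ ↦ ?_, fun u hu ↦ hinj _ _ fun ξ ↦ ?_⟩
  · rw [hsymbol, hg, ← mul_apply_eq_comp, Ring.mul_inverse_cancel _ (hunit _ (hp₀ ξ)),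
      one_apply_eq_self]
  · rw [hg, ← hu, hsymbol, ← mul_apply_eq_comp, Ring.inverse_mul_cancel _ (hunit _ (hp₀ ξ)),
      one_apply_eq_self]

/-- Existence and uniqueness part of Theorem 5.1 in the Hilbert-space case: for every Schwartz
datum `f`, every `λ ∈ S_φ` and every `t ∈ (0,∞)ⁿ` there is a unique Schwartz solution `u` of
`∑ k, (-1)^(l k) t k ∂ₖ^(2 l k) u + A u + λ u = f`. -/
theorem existence_uniqueness_hilbert {H : Type*} [NormedAddCommGroup H] [InnerProductSpace ℂ H]
    [CompleteSpace H] (A : H →L[ℂ] H) (hA : IsSelfAdjoint A) (c : ℝ) (hc : 0 < c)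
    (hcoer : ∀ u : H, c * ‖u‖ ^ 2 ≤ (inner ℂ (A u) u : ℂ).re)
    (n : ℕ) (l : Fin n → ℕ) (hl : ∀ k, 0 < l k)
    (φ : ℝ) (hφ0 : 0 ≤ φ) (hφπ : φ < Real.pi) :
    ∀ f : SchwartzMap (Fin n → ℝ) H, ∀ z ∈ Sector φ, ∀ t : Fin n → ℝ, (∀ k, 0 < t k) →
      ∃! u : SchwartzMap (Fin n → ℝ) H,
        ∀ x, (∑ k, ((-1 : ℝ) ^ (l k) * t k) • pdIter n k (2 * l k) u x) + A (u x) + z • u x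
          = f x := by
  intro f z hz t ht
  obtain ⟨δ, hδ, hlow⟩ := exists_le_norm_inner_add_sector hA hc hcoer hφπ hz
  set e : (Fin n → ℝ) ≃L[ℝ] EuclideanSpace ℝ (Fin n) := (EuclideanSpace.equiv (Fin n) ℝ).symm
  have htransfer : ∀ (u : 𝓢(EuclideanSpace ℝ (Fin n), H)) (x : Fin n → ℝ),
      (∑ k, ((-1 : ℝ) ^ l k * t k) •
          pdIter n k (2 * l k) (compCLMOfContinuousLinearEquiv ℂ e u) x) +
        A (compCLMOfContinuousLinearEquiv ℂ e u x) +
        z • compCLMOfContinuousLinearEquiv ℂ e u x =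
      ((∑ k, ((-1 : ℝ) ^ l k * t k) • ∂_{e (Pi.single k 1)}^[2 * l k] u) + u.postcompCLM A +
        z • u) (e x) := by
    intro u x
    simp [pdIter_compCLMOfContinuousLinearEquiv]
  obtain ⟨u, hu, huniq⟩ := existsUnique_schwartz_sum_lineDerivOp_add A z hδ hlow
    (fun k : Fin n ↦ e (Pi.single k 1)) l t (fun k ↦ (ht k).le)
    (compCLMOfContinuousLinearEquiv ℂ e.symm f)
  refine ⟨compCLMOfContinuousLinearEquiv ℂ e u, fun x ↦ ?_, fun w hw ↦ ?_⟩
  · rw [htransfer, hu]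
    simp
  · have hback : w = compCLMOfContinuousLinearEquiv ℂ e
        (compCLMOfContinuousLinearEquiv ℂ e.symm w) := by
      ext x
      simp
    rw [hback] at hw ⊢
    congr 1
    refine huniq _ ?_
    ext y
    have := hw (e.symm y)
    rw [htransfer, e.apply_symm_apply] at this
    exact this
end
end

section
/- Let s > 0, let l₁,…,lₙ be positive integers, let α = (α₁,…,αₙ) be a multi-index with ϰ := Σₖ αₖ/lₖ ≤ 1, and let 0 ≤ μ ≤ 1 − ϰ. Then there exists C_μ > 0 such that for every Schwartz function u ∈ S(ℝⁿ; ℓ²(ℕ, ℂ)) with components uᵢ (i ∈ ℕ) satisfying ∫_{ℝⁿ} Σᵢ 4^{s i} |uᵢ(x)|² dx < ∞, and for every h > 0: ( ∫_{ℝⁿ} Σᵢ 2^{2 s i (1−ϰ−μ)} |D^α uᵢ(x)|² dx )^{1/2} ≤ C_μ [ h^μ ( ( ∫_{ℝⁿ} Σᵢ 4^{s i} |uᵢ(x)|² dx )^{1/2} + Σₖ ‖∂ₖ^{lₖ} u‖_{L²(ℝⁿ;ℓ²)} + ‖u‖_{L²(ℝⁿ;ℓ²)} ) + h^{−(1−μ)}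 ‖u‖_{L²(ℝⁿ;ℓ²)} ]. -/
open MeasureTheory
open scoped ENNReal

noncomputable section

/-- The mixed partial derivative `D^α u = ∂₁^{α₁} ⋯ ∂ₙ^{αₙ} u` of a Schwartz function. -/
def Dmix (n : ℕ) {H : Type*} [NormedAddCommGroup H] [NormedSpace ℝ H] (α : Fin n → ℕ)
    (u : SchwartzMap (Fin n → ℝ) H) : SchwartzMap (Fin n → ℝ) H :=
  (List.finRange n).foldl (fun v k => pdIter n k (α k) v) u

/-- The Bochner `L²(ℝⁿ; H)` norm of a function. -/
def L2N (n : ℕ) {H : Type*} [NormedAddCommGroup H] (f : (Fin n → ℝ) → H) : ℝ :=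
  (∫ x, ‖f x‖ ^ 2) ^ ((1 : ℝ) / 2)

/-- The weighted integral `∫ ∑ᵢ w^(s i) |fᵢ(x)|² dx` (as an extended real), for an
`ℓ²`-valued function `f` and a weight base `w > 0`. -/
def wInt (n : ℕ) (w s : ℝ) (f : (Fin n → ℝ) → lp (fun _ : ℕ => ℂ) 2) : ℝ≥0∞ :=
  ∫⁻ x, ∑' i : ℕ, ENNReal.ofReal (w ^ (s * (i : ℝ)) * ‖f x i‖ ^ 2)

open scoped FourierTransform LineDeriv SchwartzMap

/-- The `i`-th component of an `ℓ²`-valued Schwartz function, regarded as a Schwartz function on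
Euclidean space. -/
def euclideanComponent (n : ℕ) (i : ℕ) (u : 𝓢(Fin n → ℝ, lp (fun _ : ℕ => ℂ) 2)) :
    𝓢(EuclideanSpace ℝ (Fin n), ℂ) :=
  SchwartzMap.compCLMOfContinuousLinearEquiv ℝ (EuclideanSpace.equiv (Fin n) ℝ)
    (SchwartzMap.postcompCLM (lp.evalCLM ℝ (fun _ : ℕ => ℂ) 2 i) u)

theorem euclideanComponent_apply (n i : ℕ) (u : 𝓢(Fin n → ℝ, lp (fun _ : ℕ => ℂ) 2))
    (x : EuclideanSpace ℝ (Fin n)) : euclideanComponent n i u x = u x.ofLp i := rfl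

theorem euclideanComponent_lineDerivOp (n i : ℕ) (u : 𝓢(Fin n → ℝ, lp (fun _ : ℕ => ℂ) 2))
    (k : Fin n) :
    euclideanComponent n i (∂_{(Pi.single k 1 : Fin n → ℝ)} u) =
      ∂_{EuclideanSpace.single k (1 : ℝ)} (euclideanComponent n i u) := by
  rw [euclideanComponent, euclideanComponent,
    SchwartzMap.lineDerivOp_compCLMOfContinuousLinearEquiv]
  congr 1
  ext x
  change lp.evalCLM ℝ (fun _ : ℕ => ℂ) 2 i (∂_{(Pi.single k 1 : Fin n → ℝ)} u x) =
    ∂_{(Pi.single k 1 : Fin n → ℝ)}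
      (SchwartzMap.postcompCLM (lp.evalCLM ℝ (fun _ : ℕ => ℂ) 2 i) u) x
  rw [SchwartzMap.lineDerivOp_apply_eq_fderiv, SchwartzMap.lineDerivOp_apply_eq_fderiv]
  have h := ((lp.evalCLM ℝ (fun _ : ℕ => ℂ) 2 i).hasFDerivAt.comp x
    (u.differentiableAt (x := x)).hasFDerivAt).fderiv
  exact (congrArg (fun L => L (Pi.single k 1)) h).symm

theorem norm_fourier_lineDerivOp_single (n : ℕ) (f : 𝓢(EuclideanSpace ℝ (Fin n), ℂ)) (k : Fin n)
    (ξ : EuclideanSpace ℝ (Fin n)) :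
    ‖𝓕 (∂_{EuclideanSpace.single k (1 : ℝ)} f) ξ‖ = 2 * Real.pi * |ξ k| * ‖𝓕 f ξ‖ := by
  rw [SchwartzMap.fourier_lineDerivOp_eq, smul_apply,
    SchwartzMap.smulLeftCLM_apply_apply (by fun_prop)]
  simp [abs_of_pos Real.pi_pos, mul_assoc, EuclideanSpace.inner_single_right]

theorem norm_fourier_pdIter (n i : ℕ) (k : Fin n) (m : ℕ)
    (u : 𝓢(Fin n → ℝ, lp (fun _ : ℕ => ℂ) 2)) (ξ : EuclideanSpace ℝ (Fin n)) :
    ‖𝓕 (euclideanComponent n i (pdIter n k m u)) ξ‖ =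
      (2 * Real.pi * |ξ k|) ^ m * ‖𝓕 (euclideanComponent n i u) ξ‖ := by
  induction m with
  | zero => simp [pdIter]
  | succ m ih =>
    have h : pdIter n k (m + 1) u = ∂_{(Pi.single k 1 : Fin n → ℝ)} (pdIter n k m u) := by
      simp [pdIter, Function.iterate_succ_apply']
    rw [h, euclideanComponent_lineDerivOp, norm_fourier_lineDerivOp_single, ih]
    ring

theorem norm_fourier_foldl_pdIter (n i : ℕ) (α : Fin n → ℕ) (L : List (Fin n))
    (u : 𝓢(Fin n → ℝ, lp (fun _ : ℕ => ℂ) 2)) (ξ : EuclideanSpace ℝ (Fin n)) :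
    ‖𝓕 (euclideanComponent n i (L.foldl (fun v k => pdIter n k (α k) v) u)) ξ‖ =
      (L.map fun k => (2 * Real.pi * |ξ k|) ^ α k).prod *
        ‖𝓕 (euclideanComponent n i u) ξ‖ := by
  induction L generalizing u with
  | nil => simp
  | cons k L ih =>
    rw [List.foldl_cons, ih, norm_fourier_pdIter, List.map_cons, List.prod_cons]
    ring

theorem norm_fourier_Dmix (n i : ℕ) (α : Fin n → ℕ)
    (u : 𝓢(Fin n → ℝ, lp (fun _ : ℕ => ℂ) 2)) (ξ : EuclideanSpace ℝ (Fin n)) :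
    ‖𝓕 (euclideanComponent n i (Dmix n α u)) ξ‖ =
      (∏ k, (2 * Real.pi * |ξ k|) ^ α k) * ‖𝓕 (euclideanComponent n i u) ξ‖ := by
  rw [Dmix, norm_fourier_foldl_pdIter, Fin.prod_univ_def]

theorem integrable_norm_sq {V H : Type*} [NormedAddCommGroup V] [NormedSpace ℝ V]
    [MeasurableSpace V] [BorelSpace V] [SecondCountableTopology V]
    [NormedAddCommGroup H] [NormedSpace ℝ H] (μ : Measure V) [μ.HasTemperateGrowth]
    (f : 𝓢(V, H)) : Integrable (fun x => ‖f x‖ ^ 2) μ :=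
  (memLp_two_iff_integrable_sq_norm (f.memLp 2 μ).1).1 (f.memLp 2 μ)

theorem lintegral_component_eq_lintegral_fourier (n i : ℕ)
    (u : 𝓢(Fin n → ℝ, lp (fun _ : ℕ => ℂ) 2)) :
    ∫⁻ x, ENNReal.ofReal (‖u x i‖ ^ 2) =
      ∫⁻ ξ, ENNReal.ofReal (‖𝓕 (euclideanComponent n i u) ξ‖ ^ 2) := by
  have h : ∫⁻ x, ENNReal.ofReal (‖u x i‖ ^ 2) =
      ∫⁻ ξ, ENNReal.ofReal (‖euclideanComponent n i u ξ‖ ^ 2) :=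
    ((PiLp.volume_preserving_ofLp (Fin n)).lintegral_comp_emb
      (MeasurableEquiv.toLp 2 (Fin n → ℝ)).symm.measurableEmbedding
      fun x => ENNReal.ofReal (‖u x i‖ ^ 2)).symm
  rw [h, ← ofReal_integral_eq_lintegral_ofReal (integrable_norm_sq _ _)
      (.of_forall fun _ => by positivity),
    ← ofReal_integral_eq_lintegral_ofReal (integrable_norm_sq _ _)
      (.of_forall fun _ => by positivity), SchwartzMap.integral_norm_sq_fourier]

theorem continuous_component (n i : ℕ) (u : 𝓢(Fin n → ℝ, lp (fun _ : ℕ => ℂ) 2)) :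
    Continuous fun x => u x i :=
  (lp.evalCLM ℝ (fun _ : ℕ => ℂ) 2 i).continuous.comp u.continuous

/-- Plancherel's identity for the weighted `ℓ²`-valued integral. -/
theorem lintegral_tsum_weight_eq (n : ℕ) (w : ℕ → ℝ) (hw : ∀ i, 0 ≤ w i)
    (u : 𝓢(Fin n → ℝ, lp (fun _ : ℕ => ℂ) 2)) :
    ∫⁻ x, ∑' i : ℕ, ENNReal.ofReal (w i * ‖u x i‖ ^ 2) =
      ∑' i : ℕ, ∫⁻ ξ, ENNReal.ofReal (w i * ‖𝓕 (euclideanComponent n i u) ξ‖ ^ 2) := by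
  have hm : ∀ i, Measurable fun x => ENNReal.ofReal (‖u x i‖ ^ 2) := fun i =>
    ((continuous_component n i u).norm.pow 2).measurable.ennreal_ofReal
  simp_rw [ENNReal.ofReal_mul (hw _)]
  rw [lintegral_tsum fun i => ((hm i).const_mul _).aemeasurable]
  refine tsum_congr fun i => ?_
  rw [lintegral_const_mul' _ _ ENNReal.ofReal_ne_top,
    lintegral_const_mul' _ _ ENNReal.ofReal_ne_top, lintegral_component_eq_lintegral_fourier]

theorem ofReal_L2N_sq (n : ℕ) (u : 𝓢(Fin n → ℝ, lp (fun _ : ℕ => ℂ) 2)) :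
    ENNReal.ofReal (L2N n (fun x => u x) ^ 2) =
      ∑' i : ℕ, ∫⁻ ξ, ENNReal.ofReal (‖𝓕 (euclideanComponent n i u) ξ‖ ^ 2) := by
  have h := lintegral_tsum_weight_eq n (fun _ => 1) (fun _ => zero_le_one) u
  simp only [one_mul] at h
  rw [← h, L2N, ← Real.sqrt_eq_rpow, Real.sq_sqrt (integral_nonneg fun _ => by positivity),
    ofReal_integral_eq_lintegral_ofReal (integrable_norm_sq _ _)
      (.of_forall fun _ => by positivity)]
  refine lintegral_congr fun x => ?_
  have hx := lp.hasSum_norm (p := 2) (by norm_num) (u x)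
  norm_num at hx
  rw [← hx.tsum_eq, ENNReal.ofReal_tsum_of_nonneg (fun _ => by positivity) hx.summable]

theorem L2N_nonneg (n : ℕ) {H : Type*} [NormedAddCommGroup H] (f : (Fin n → ℝ) → H) :
    0 ≤ L2N n f :=
  Real.rpow_nonneg (integral_nonneg fun _ => by positivity) _

theorem Real.rpow_one_sub_le_mul_add {M h μ : ℝ} (hM : 0 < M) (hh : 0 < h) (hμ0 : 0 ≤ μ)
    (hμ1 : μ ≤ 1) : (M ^ (1 - μ)) ^ 2 ≤ (h ^ μ * M) ^ 2 + (h ^ (-(1 - μ))) ^ 2 := by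
  rcases le_total 1 (h * M) with hc | hc
  · have h1 : M ^ (1 - μ) ≤ h ^ μ * M := by
      have h2 : 1 ≤ h ^ μ * M ^ μ := by
        rw [← Real.mul_rpow hh.le hM.le]; exact Real.one_le_rpow hc hμ0
      calc M ^ (1 - μ) ≤ (h ^ μ * M ^ μ) * M ^ (1 - μ) :=
            le_mul_of_one_le_left (by positivity) h2
        _ = h ^ μ * M := by
            rw [mul_assoc, ← Real.rpow_add hM, add_sub_cancel, Real.rpow_one]
    have := pow_le_pow_left₀ (by positivity) h1 2
    nlinarith [sq_nonneg (h ^ (-(1 - μ)))]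
  · have h1 : M ^ (1 - μ) ≤ h ^ (-(1 - μ)) := by
      rw [Real.rpow_neg hh.le, ← Real.inv_rpow hh.le]
      refine Real.rpow_le_rpow hM.le ?_ (by linarith)
      rw [← one_div, le_div_iff₀ hh]; linarith
    have := pow_le_pow_left₀ (by positivity) h1 2
    nlinarith [sq_nonneg (h ^ μ * M)]

theorem prod_pow_le_rpow_sum_div {ι : Type*} [Fintype ι] {η : ι → ℝ} (hη : ∀ k, 0 ≤ η k)
    {l : ι → ℕ} (hl : ∀ k, 0 < l k) (α : ι → ℕ) {M : ℝ} (hM : 0 < M)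
    (h : ∀ k, η k ^ l k ≤ M) :
    ∏ k, η k ^ α k ≤ M ^ ∑ k, (α k : ℝ) / (l k : ℝ) := by
  rw [Real.rpow_sum_of_pos hM]
  refine Finset.prod_le_prod (fun k _ => pow_nonneg (hη k) _) fun k _ => ?_
  have hlk : (l k : ℝ) ≠ 0 := by exact_mod_cast (hl k).ne'
  calc η k ^ α k = (η k ^ l k) ^ ((α k : ℝ) / (l k : ℝ)) := by
        rw [← Real.rpow_natCast (η k) (l k), ← Real.rpow_mul (hη k), mul_div_cancel₀ _ hlk,
          Real.rpow_natCast]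
    _ ≤ _ := Real.rpow_le_rpow (pow_nonneg (hη k) _) (h k) (by positivity)

/-- The Fourier multiplier bound behind the embedding estimate. -/
theorem multiplier_bound {n : ℕ} {l : Fin n → ℕ} (hl : ∀ k, 0 < l k) (α : Fin n → ℕ) {μ : ℝ}
    (hμ0 : 0 ≤ μ) (hμ1 : μ ≤ 1 - ∑ k, (α k : ℝ) / (l k : ℝ)) {t h : ℝ} (ht : 0 < t) (hh : 0 < h)
    {η : Fin n → ℝ} (hη : ∀ k, 0 ≤ η k) :
    (t ^ (1 - (∑ k, (α k : ℝ) / (l k : ℝ)) - μ) * ∏ k, η k ^ α k) ^ 2 ≤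
      2 * (n + 1) * ((h ^ μ) ^ 2 * (t ^ 2 + ∑ k, (η k ^ l k) ^ 2) + (h ^ (-(1 - μ))) ^ 2) := by
  set κ := ∑ k, (α k : ℝ) / (l k : ℝ) with hκ
  have hκ0 : 0 ≤ κ := Finset.sum_nonneg fun k _ => by positivity
  set S := ∑ k, η k ^ l k with hS
  have hS0 : 0 ≤ S := Finset.sum_nonneg fun k _ => pow_nonneg (hη k) _
  have hM : 0 < t + S := by linarith
  have hprod : ∏ k, η k ^ α k ≤ (t + S) ^ κ := by
    refine prod_pow_le_rpow_sum_div hη hl α hM fun k => ?_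
    have := Finset.single_le_sum (f := fun k => η k ^ l k)
      (fun k _ => pow_nonneg (hη k) _) (Finset.mem_univ k)
    linarith
  have hprod0 : 0 ≤ ∏ k, η k ^ α k := Finset.prod_nonneg fun k _ => pow_nonneg (hη k) _
  have h1 : t ^ (1 - κ - μ) * ∏ k, η k ^ α k ≤ (t + S) ^ (1 - μ) :=
    calc t ^ (1 - κ - μ) * ∏ k, η k ^ α k ≤ (t + S) ^ (1 - κ - μ) * (t + S) ^ κ := by
          refine mul_le_mul (Real.rpow_le_rpow ht.le (by linarith) (by linarith)) hprod hprod0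
            (by positivity)
      _ = (t + S) ^ (1 - μ) := by rw [← Real.rpow_add hM]; congr 1; ring
  have hSQ : S ^ 2 ≤ n * ∑ k, (η k ^ l k) ^ 2 := by
    simpa using sq_sum_le_card_mul_sum_sq (s := Finset.univ) (f := fun k => η k ^ l k)
  have hQ : 0 ≤ ∑ k, (η k ^ l k) ^ 2 := Finset.sum_nonneg fun k _ => by positivity
  generalize (∑ k, (η k ^ l k) ^ 2) = Q at *
  have hn : (0 : ℝ) ≤ n := n.cast_nonneg
  have hMQ : (t + S) ^ 2 ≤ 2 * (n + 1) * (t ^ 2 + Q) := by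
    nlinarith [sq_nonneg (t - S), mul_nonneg hn (sq_nonneg t)]
  calc _ ≤ ((t + S) ^ (1 - μ)) ^ 2 := pow_le_pow_left₀ (by positivity) h1 2
    _ ≤ (h ^ μ * (t + S)) ^ 2 + (h ^ (-(1 - μ))) ^ 2 :=
        Real.rpow_one_sub_le_mul_add hM hh hμ0 (by linarith)
    _ ≤ _ := by
        rw [mul_pow]
        nlinarith [mul_le_mul_of_nonneg_left hMQ (sq_nonneg (h ^ μ)),
          mul_nonneg hn (sq_nonneg (h ^ (-(1 - μ)))), sq_nonneg (h ^ (-(1 - μ)))]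

/-- The squared embedding estimate, with every term written on the Fourier side. -/
theorem tsum_lintegral_fourier_Dmix_le {s : ℝ} {n : ℕ} {l : Fin n → ℕ} (hl : ∀ k, 0 < l k)
    (α : Fin n → ℕ) {μ : ℝ} (hμ0 : 0 ≤ μ) (hμ1 : μ ≤ 1 - ∑ k, (α k : ℝ) / (l k : ℝ))
    (u : 𝓢(Fin n → ℝ, lp (fun _ : ℕ => ℂ) 2)) {h : ℝ} (hh : 0 < h) :
    ∑' i : ℕ, ∫⁻ ξ, ENNReal.ofReal
        ((2 : ℝ) ^ (2 * s * (i : ℝ) * (1 - (∑ k, (α k : ℝ) / (l k : ℝ)) - μ)) *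
          ‖𝓕 (euclideanComponent n i (Dmix n α u)) ξ‖ ^ 2) ≤
      ENNReal.ofReal (2 * (n + 1)) * (ENNReal.ofReal ((h ^ μ) ^ 2) *
        ((∑' i : ℕ, ∫⁻ ξ, ENNReal.ofReal
            ((4 : ℝ) ^ (s * (i : ℝ)) * ‖𝓕 (euclideanComponent n i u) ξ‖ ^ 2)) +
          ∑ k, ∑' i : ℕ, ∫⁻ ξ, ENNReal.ofReal
            (‖𝓕 (euclideanComponent n i (pdIter n k (l k) u)) ξ‖ ^ 2)) +
        ENNReal.ofReal ((h ^ (-(1 - μ))) ^ 2) *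
          ∑' i : ℕ, ∫⁻ ξ, ENNReal.ofReal (‖𝓕 (euclideanComponent n i u) ξ‖ ^ 2)) := by
  have hm : ∀ i (v : 𝓢(Fin n → ℝ, lp (fun _ : ℕ => ℂ) 2)), Measurable fun ξ =>
      ENNReal.ofReal (‖𝓕 (euclideanComponent n i v) ξ‖ ^ 2) := fun i v =>
    ((𝓕 (euclideanComponent n i v)).continuous.norm.pow 2).measurable.ennreal_ofReal
  have hmw : ∀ i (c : ℝ), Measurable fun ξ =>
      ENNReal.ofReal (c * ‖𝓕 (euclideanComponent n i u) ξ‖ ^ 2) := fun i c =>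
    (((𝓕 (euclideanComponent n i u)).continuous.norm.pow 2).measurable.const_mul c).ennreal_ofReal
  rw [← Summable.tsum_finsetSum fun _ _ => ENNReal.summable, ← ENNReal.tsum_add,
    ← ENNReal.tsum_mul_left, ← ENNReal.tsum_mul_left, ← ENNReal.tsum_add, ← ENNReal.tsum_mul_left]
  refine ENNReal.tsum_le_tsum fun i => ?_
  rw [← lintegral_finsetSum _ fun k _ => hm i _, ← lintegral_add_left (hmw i _),
    ← lintegral_const_mul' _ _ ENNReal.ofReal_ne_top,
    ← lintegral_const_mul' _ _ ENNReal.ofReal_ne_top,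
    ← lintegral_add_right _ ((hm i u).const_mul _),
    ← lintegral_const_mul' _ _ ENNReal.ofReal_ne_top]
  refine lintegral_mono fun ξ => ?_
  simp only []
  rw [← ENNReal.ofReal_sum_of_nonneg fun _ _ => by positivity,
    ← ENNReal.ofReal_add (by positivity) (Finset.sum_nonneg fun _ _ => by positivity),
    ← ENNReal.ofReal_mul (by positivity), ← ENNReal.ofReal_mul (by positivity),
    ← ENNReal.ofReal_add (mul_nonneg (by positivity) (add_nonneg (by positivity)
      (Finset.sum_nonneg fun _ _ => by positivity))) (by positivity),
    ← ENNReal.ofReal_mul (by positivity)]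
  refine ENNReal.ofReal_le_ofReal ?_
  simp_rw [norm_fourier_Dmix, norm_fourier_pdIter, mul_pow _ ‖_‖ 2, ← Finset.sum_mul]
  have key := mul_le_mul_of_nonneg_right
    (multiplier_bound hl α hμ0 hμ1 (t := (2 : ℝ) ^ (s * (i : ℝ))) (by positivity) hh
      (η := fun k => 2 * Real.pi * |ξ k|) fun k => by positivity)
    (sq_nonneg ‖𝓕 (euclideanComponent n i u) ξ‖)
  have h4 : (4 : ℝ) ^ (s * (i : ℝ)) = ((2 : ℝ) ^ (s * (i : ℝ))) ^ 2 := by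
    rw [show (4 : ℝ) = 2 * 2 by norm_num, Real.mul_rpow (by norm_num) (by norm_num), sq]
  have h2 : ∀ c : ℝ, (2 : ℝ) ^ (2 * s * (i : ℝ) * c) = (((2 : ℝ) ^ (s * (i : ℝ))) ^ c) ^ 2 := by
    intro c
    rw [← Real.rpow_natCast, ← Real.rpow_mul (by positivity), ← Real.rpow_mul (by positivity)]
    congr 1
    push_cast
    ring
  rw [h4, h2]
  refine le_of_eq_of_le ?_ (key.trans_eq ?_)
  · ring
  · ring

theorem mul_sq_add_sq_le_sq {K a b X Y Z Q : ℝ} (hK : 1 ≤ K) (ha : 0 ≤ a) (hb : 0 ≤ b)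
    (hX : 0 ≤ X) (hY : 0 ≤ Y) (hZ : 0 ≤ Z) (hQ : 0 ≤ Q) (hQY : Q ≤ Y ^ 2) :
    K * (a ^ 2 * (X ^ 2 + Q) + b ^ 2 * Z ^ 2) ≤ (K * (a * (X + Y + Z) + b * Z)) ^ 2 := by
  have h1 : a ^ 2 * (X ^ 2 + Q) + b ^ 2 * Z ^ 2 ≤ (a * (X + Y + Z) + b * Z) ^ 2 :=
    calc a ^ 2 * (X ^ 2 + Q) + b ^ 2 * Z ^ 2
        ≤ a ^ 2 * (X + Y + Z) ^ 2 + b ^ 2 * Z ^ 2 := by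
          gcongr
          nlinarith [mul_nonneg hX hY, mul_nonneg hX hZ, mul_nonneg hY hZ, sq_nonneg Z]
      _ ≤ _ := by
          have : 0 ≤ (a * (X + Y + Z)) * (b * Z) := by positivity
          nlinarith
  rw [mul_pow]
  exact mul_le_mul (le_self_pow₀ hK two_ne_zero) h1 (by positivity) (by positivity)

/-- Result 4.1 of the paper with `ν = 2`, `p = q = 2`, weight `γ ≡ 1`, for the diagonal
positive operator `A = diag(2^(s i))` on `ℓ²`: a weighted embedding estimate for the
mixed derivative `D^α` of `ℓ²`-valued Schwartz functions. -/
theorem diagonal_weighted_embedding (s : ℝ) (hs : 0 < s) (n : ℕ) (l : Fin n → ℕ)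
    (hl : ∀ k, 0 < l k) (α : Fin n → ℕ) (hϰ : (∑ k, (α k : ℝ) / (l k : ℝ)) ≤ 1)
    (μ : ℝ) (hμ0 : 0 ≤ μ) (hμ1 : μ ≤ 1 - ∑ k, (α k : ℝ) / (l k : ℝ)) :
    ∃ C : ℝ, 0 < C ∧ ∀ u : SchwartzMap (Fin n → ℝ) (lp (fun _ : ℕ => ℂ) 2),
      wInt n 4 s (fun x => u x) < ⊤ → ∀ h : ℝ, 0 < h →
      (∫⁻ x, ∑' i : ℕ, ENNReal.ofReal
          ((2 : ℝ) ^ (2 * s * (i : ℝ) * (1 - (∑ k, (α k : ℝ) / (l k : ℝ)) - μ)) *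
            ‖(Dmix n α u) x i‖ ^ 2)) ^ ((1 : ℝ) / 2)
      ≤ ENNReal.ofReal (C * (h ^ μ * ((wInt n 4 s (fun x => u x)).toReal ^ ((1 : ℝ) / 2) +
              (∑ k, L2N n (fun x => pdIter n k (l k) u x)) + L2N n (fun x => u x)) +
             h ^ (-(1 - μ)) * L2N n (fun x => u x))) := by
  refine ⟨2 * (n + 1), by positivity, fun u hu h hh => ?_⟩
  set X := (wInt n 4 s (fun x => u x)).toReal ^ ((1 : ℝ) / 2) with hX
  have hX0 : 0 ≤ X := Real.rpow_nonneg ENNReal.toReal_nonneg _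
  have hX2 : ENNReal.ofReal (X ^ 2) = ∑' i : ℕ, ∫⁻ ξ, ENNReal.ofReal
      ((4 : ℝ) ^ (s * (i : ℝ)) * ‖𝓕 (euclideanComponent n i u) ξ‖ ^ 2) := by
    rw [hX, ← Real.sqrt_eq_rpow, Real.sq_sqrt ENNReal.toReal_nonneg, ENNReal.ofReal_toReal hu.ne,
      wInt, lintegral_tsum_weight_eq n _ fun i => by positivity]
  rw [lintegral_tsum_weight_eq n _ fun i => by positivity]
  have key := tsum_lintegral_fourier_Dmix_le (s := s) hl α hμ0 hμ1 u hh
  simp_rw [← ofReal_L2N_sq] at key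
  rw [← hX2] at key
  have hY0 : ∀ k, 0 ≤ L2N n (fun x => pdIter n k (l k) u x) := fun k => L2N_nonneg n _
  have hYS : ∑ k, L2N n (fun x => pdIter n k (l k) u x) ^ 2 ≤
      (∑ k, L2N n (fun x => pdIter n k (l k) u x)) ^ 2 :=
    Finset.sum_sq_le_sq_sum_of_nonneg fun k _ => hY0 k
  have hY0S : 0 ≤ ∑ k, L2N n (fun x => pdIter n k (l k) u x) := Finset.sum_nonneg fun k _ => hY0 k
  have hQ0 : 0 ≤ ∑ k, L2N n (fun x => pdIter n k (l k) u x) ^ 2 :=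
    Finset.sum_nonneg fun k _ => sq_nonneg _
  have hZ0 : 0 ≤ L2N n (fun x => u x) := L2N_nonneg n _
  have ha : 0 ≤ h ^ μ := Real.rpow_nonneg hh.le _
  have hb : 0 ≤ h ^ (-(1 - μ)) := Real.rpow_nonneg hh.le _
  have hK : (1 : ℝ) ≤ 2 * (n + 1) := by
    have : (0 : ℝ) ≤ n := n.cast_nonneg
    linarith
  rw [← ENNReal.ofReal_sum_of_nonneg fun k _ => sq_nonneg _,
    ← ENNReal.ofReal_add (sq_nonneg _) hQ0, ← ENNReal.ofReal_mul (sq_nonneg _),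
    ← ENNReal.ofReal_mul (sq_nonneg _),
    ← ENNReal.ofReal_add (mul_nonneg (sq_nonneg _) (add_nonneg (sq_nonneg _) hQ0))
      (mul_nonneg (sq_nonneg _) (sq_nonneg _)),
    ← ENNReal.ofReal_mul (zero_le_one.trans hK)] at key
  refine (ENNReal.rpow_le_rpow (key.trans (ENNReal.ofReal_le_ofReal
    (mul_sq_add_sq_le_sq hK ha hb hX0 hY0S hZ0 hQ0 hYS))) (by norm_num)).trans_eq ?_
  rw [ENNReal.ofReal_rpow_of_nonneg (sq_nonneg _) (by norm_num), ← Real.sqrt_eq_rpow,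
    Real.sqrt_sq (mul_nonneg (zero_le_one.trans hK) (add_nonneg
      (mul_nonneg ha (add_nonneg (add_nonneg hX0 hY0S) hZ0)) (mul_nonneg hb hZ0)))]
end
end
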